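/- For positive integers p, q, r with r >= 2 and p + q + r odd, R(p,q,r) = (-1)^p * N_1(r,p,q) + (-1)^p * N_1(p,r,q) + (-1)^q * N_2(r,q,p) + (-1)^q * N_3(q,r,p), where N_1(a,b,s) = sum_{j=0}^{floor(a/2)} binom(a+b-2j-1, b-1)*(2^{2j+1-a-b-s} - 1)*zeta(2j)*zeta(a+b+s-2j), N_2(a,b,s) = sum_{j=0}^{floor(a/2)} binom(a+b-2j-1, b-1)*(2^{1-2j} - 1)*(2^{2j+1-a-b-s} - 1)*zeta(2j)*zeta(a+b+s-2j), and N_3(a,b,s) = sum_{j=0}^{floor(a/2)} binom(a+b-2j-1, b-1)*(2^{1-2j} - 1)*zeta(2j)*zeta(a+b+s-2j); in particular R(p,q,r) is a rational polynomial in zeta values zeta(j), 2 <= j <= p+q+r, and pi^2 does not appear beyond these. -/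

import Mathlib

open Finset

noncomputable def tornheimR (s₁ s₂ s₃ : ℝ) : ℝ :=
  ∑' (m : ℕ) (n : ℕ),
    (-1 : ℝ) ^ (n + 1) /
      (((m : ℝ) + 1) ^ s₁ * ((n : ℝ) + 1) ^ s₂ * ((m : ℝ) + (n : ℝ) + 2) ^ s₃)

noncomputable def N₁ (a b s : ℕ) : ℂ :=
  ∑ j ∈ Finset.range (a / 2 + 1),
    ((a + b - 2 * j - 1).choose (b - 1) : ℂ) *
      ((2 : ℂ) ^ ((2 * j + 1 : ℤ) - a - b - s) - 1) * riemannZeta (2 * j) *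
      riemannZeta ((a + b + s - 2 * j : ℕ))

noncomputable def N₂ (a b s : ℕ) : ℂ :=
  ∑ j ∈ Finset.range (a / 2 + 1),
    ((a + b - 2 * j - 1).choose (b - 1) : ℂ) *
      ((2 : ℂ) ^ ((1 : ℤ) - 2 * j) - 1) *
      ((2 : ℂ) ^ ((2 * j + 1 : ℤ) - a - b - s) - 1) * riemannZeta (2 * j) *
      riemannZeta ((a + b + s - 2 * j : ℕ))

noncomputable def N₃ (a b s : ℕ) : ℂ :=
  ∑ j ∈ Finset.range (a / 2 + 1),
    ((a + b - 2 * j - 1).choose (b - 1) : ℂ) *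
      ((2 : ℂ) ^ ((1 : ℤ) - 2 * j) - 1) * riemannZeta (2 * j) *
      riemannZeta ((a + b + s - 2 * j : ℕ))

/-- The coefficient of `ζ(2j)` in the expansion of `∑ₘ 1 / (m ^ a * (m + n) ^ b)`, extended to
`b = 0` so that it obeys Pascal's rule on the whole quadrant. -/
def pascalCoeff (j a b : ℕ) : ℕ :=
  if b = 0 then (if a = 2 * j then 1 else 0)
  else if 2 * j ≤ a then (a + b - 2 * j - 1).choose (b - 1) else 0

theorem pascalCoeff_succ_succ (j a b : ℕ) :
    pascalCoeff j (a + 1) (b + 1) = pascalCoeff j a (b + 1) + pascalCoeff j (a + 1) b := by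
  rcases lt_trichotomy (2 * j) (a + 1) with h | h | h
  · rcases b with _ | b
    · simp [pascalCoeff, show 2 * j ≤ a + 1 by omega, show 2 * j ≤ a by omega,
        show ¬ a + 1 = 2 * j by omega]
    · simp only [pascalCoeff, Nat.add_eq_zero_iff, one_ne_zero, and_false, if_false,
        show 2 * j ≤ a + 1 by omega, show 2 * j ≤ a by omega, if_true]
      rw [show a + 1 + (b + 1 + 1) - 2 * j - 1 = (a + b + 1 - 2 * j) + 1 by omega,
        show b + 1 + 1 - 1 = b + 1 by omega, Nat.choose_succ_succ,
        show a + (b + 1 + 1) - 2 * j - 1 = a + b + 1 - 2 * j by omega,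
        show a + 1 + (b + 1) - 2 * j - 1 = a + b + 1 - 2 * j by omega, add_comm]
      simp
  · rcases b with _ | b
    · simp [pascalCoeff, h]
    · simp only [pascalCoeff, Nat.add_eq_zero_iff, one_ne_zero, and_false, if_false, h, le_refl,
        show ¬ a + 1 ≤ a by omega, if_true]
      rw [show a + 1 + (b + 1 + 1) - (a + 1) - 1 = b + 1 by omega,
        show a + 1 + (b + 1) - (a + 1) - 1 = b by omega]
      simp
  · rcases b with _ | b
    · simp [pascalCoeff, show ¬ 2 * j ≤ a + 1 by omega, show ¬ 2 * j ≤ a by omega,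
        show ¬ a + 1 = 2 * j by omega]
    · simp [pascalCoeff, show ¬ 2 * j ≤ a + 1 by omega, show ¬ 2 * j ≤ a by omega]

theorem pascalCoeff_zero_left (j b : ℕ) (hb : b ≠ 0) :
    pascalCoeff j 0 b = if j = 0 then 1 else 0 := by
  by_cases hj : j = 0 <;> simp [pascalCoeff, hb, hj]

theorem hasSum_of_eq {β : Type*} {f g : β → ℂ} {a b : ℂ} (h : HasSum f a)
    (hfg : ∀ x, g x = f x) (hab : b = a) : HasSum g b := by
  rwa [hab, show g = f from funext hfg]

theorem zpow_neg_eq_of_sign {ε : ℂ} (hε : ε = 1 ∨ ε = -1) (m : ℤ) : ε ^ (-m) = ε ^ m := by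
  rw [zpow_neg, ← inv_zpow]
  rcases hε with rfl | rfl <;> simp [inv_neg]

/-- `L` lists the values `∑ k ≥ 1, ε ^ k / k ^ s` for `s ≥ 2`, normalized by `L 0 = -1/2`. -/
def IsTwistedZeta (ε : ℂ) (L : ℕ → ℂ) : Prop :=
  L 0 = -1 / 2 ∧
    ∀ s, 2 ≤ s → HasSum (fun k : ℕ ↦ ε ^ (k + 1) * ((k + 1 : ℂ)⁻¹) ^ s) (L s)

theorem isTwistedZeta_one : IsTwistedZeta 1 (fun s ↦ riemannZeta s) := by
  refine ⟨by simp [riemannZeta_zero], fun s hs ↦ ?_⟩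
  have hsum : Summable fun n : ℕ ↦ 1 / (n : ℂ) ^ s := by
    rw [← summable_norm_iff]
    simp [show 1 < s by omega]
  have h := (hasSum_nat_add_iff' 1).2 hsum.hasSum
  rw [← zeta_nat_eq_tsum_of_gt_one hs] at h
  refine hasSum_of_eq h (fun k ↦ ?_) ?_
  · push_cast
    simp
  · simp [show s ≠ 0 by omega]

theorem isTwistedZeta_neg_one :
    IsTwistedZeta (-1) (fun s ↦ ((2 : ℂ) ^ (1 - s : ℤ) - 1) * riemannZeta s) := by
  refine ⟨by norm_num [riemannZeta_zero], fun s hs ↦ ?_⟩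
  have h1 := isTwistedZeta_one.2 s hs
  set f : ℕ → ℂ := fun k ↦ (1 + (-1) ^ (k + 1)) * ((k + 1 : ℂ)⁻¹) ^ s with hf
  have hodd : HasSum (fun k ↦ f (2 * k + 1)) (2 * 2⁻¹ ^ s * riemannZeta s) := by
    refine hasSum_of_eq (h1.mul_left (2 * 2⁻¹ ^ s)) (fun k ↦ ?_) rfl
    have : ((-1 : ℂ)) ^ (2 * k + 1 + 1) = 1 := Even.neg_one_pow ⟨k + 1, by ring⟩
    simp only [hf, this]
    rw [show ((2 * k + 1 : ℕ) + 1 : ℂ) = 2 * (k + 1) by push_cast; ring, mul_inv, mul_pow]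
    simp
    ring
  have heven : HasSum (fun k ↦ f (2 * k)) 0 := by
    refine hasSum_of_eq hasSum_zero (fun k ↦ ?_) rfl
    simp [hf, pow_succ, pow_mul]
  refine hasSum_of_eq ((HasSum.even_add_odd heven hodd).sub h1) (fun k ↦ ?_) ?_
  · simp only [hf, one_pow]
    ring
  · beta_reduce
    rw [zpow_sub₀ two_ne_zero, zpow_one, zpow_natCast, inv_pow]
    ring

theorem IsTwistedZeta.hasSum_int {ε : ℂ} (hε : ε = 1 ∨ ε = -1) {L : ℕ → ℂ}
    (hL : IsTwistedZeta ε L) {s : ℕ} (hs : 2 ≤ s) :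
    HasSum (fun m : ℤ ↦ ε ^ m * ((m : ℂ)⁻¹) ^ s) ((1 + (-1) ^ s) * L s) := by
  have h := hL.2 s hs
  refine hasSum_of_eq (HasSum.of_add_one_of_neg_add_one
    (f := fun m : ℤ ↦ ε ^ m * ((m : ℂ)⁻¹) ^ s)
    (m := L s) (m' := (-1) ^ s * L s) ?_ ?_) (fun _ ↦ rfl) ?_
  · refine hasSum_of_eq h (fun k ↦ ?_) rfl
    push_cast
    norm_cast
  · refine hasSum_of_eq (h.mul_left ((-1) ^ s)) (fun k ↦ ?_) rfl
    rw [zpow_neg_eq_of_sign hε]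
    push_cast
    rw [inv_neg, neg_pow]
    norm_cast
    ring
  · simp [show s ≠ 0 by omega]
    ring

theorem hasSum_inv_sub_inv_succ :
    HasSum (fun k : ℕ ↦ ((k : ℂ) + 1)⁻¹ - ((k : ℂ) + 1 + 1)⁻¹) 1 := by
  have h : HasSum (fun k : ℕ ↦ ((k : ℝ) + 1)⁻¹ - ((k : ℝ) + 1 + 1)⁻¹) 1 := by
    rw [hasSum_iff_tendsto_nat_of_nonneg]
    · have h2 := Finset.sum_range_sub' (fun k : ℕ ↦ ((k : ℝ) + 1)⁻¹)
      push_cast at h2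
      simp_rw [h2]
      have := tendsto_one_div_add_atTop_nhds_zero_nat (𝕜 := ℝ)
      simpa using this.const_sub 1
    · intro k
      rw [sub_nonneg]
      gcongr
      linarith
  convert Complex.hasSum_ofReal.2 h using 2
  · push_cast; rfl
  · simp

theorem hasSum_int_inv_sub_inv_succ :
    HasSum (fun m : ℤ ↦ (m : ℂ)⁻¹ - ((m : ℂ) + 1)⁻¹) 0 := by
  have h := hasSum_inv_sub_inv_succ
  refine hasSum_of_eq (HasSum.of_add_one_of_neg_add_one
    (f := fun m : ℤ ↦ (m : ℂ)⁻¹ - ((m : ℂ) + 1)⁻¹)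
    (m := 1) (m' := 0) ?_ ?_) (fun _ ↦ rfl) ?_
  · refine hasSum_of_eq h (fun k ↦ ?_) rfl
    push_cast
    rfl
  · rw [← hasSum_nat_add_iff' 1]
    refine hasSum_of_eq h (fun k ↦ ?_) ?_
    · push_cast
      rw [show (-(k + 1 + 1) + 1 : ℂ) = -(k + 1) by ring, inv_neg, inv_neg]
      ring
    · simp
  · simp

theorem hasSum_zpow_mul_inv_sub_inv_succ {ε : ℂ} (hε : ε = 1 ∨ ε = -1) :
    HasSum (fun m : ℤ ↦ ε ^ m * ((m : ℂ)⁻¹ - ((m : ℂ) + 1)⁻¹)) 0 := by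
  rcases hε with rfl | rfl
  · simpa using hasSum_int_inv_sub_inv_succ
  · have hs : Summable (fun m : ℤ ↦ (-1 : ℂ) ^ m * ((m : ℂ)⁻¹ - ((m : ℂ) + 1)⁻¹)) := by
      rw [← summable_norm_iff]
      simpa using hasSum_int_inv_sub_inv_succ.summable.norm
    have h1 := hs.hasSum
    have h2 := ((Equiv.subLeft (-1 : ℤ)).hasSum_iff).2 h1
    have h3 : HasSum (fun m : ℤ ↦ (-1 : ℂ) ^ m * ((m : ℂ)⁻¹ - ((m : ℂ) + 1)⁻¹))
        (-∑' m : ℤ, (-1 : ℂ) ^ m * ((m : ℂ)⁻¹ - ((m : ℂ) + 1)⁻¹)) := by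
      refine hasSum_of_eq h2.neg (fun m ↦ ?_) rfl
      simp only [Function.comp, Equiv.subLeft_apply]
      rw [show -1 - m = -1 + -m by ring, zpow_add₀ (by norm_num), zpow_neg_eq_of_sign (.inr rfl) m]
      push_cast
      rw [show (-1 + -m + 1 : ℂ) = -m by ring, show (-1 + -m : ℂ) = -(m + 1) by ring, inv_neg,
        inv_neg]
      rw [zpow_neg_one, inv_neg_one]
      ring
    have h4 := h1.unique h3
    rwa [self_eq_neg.1 h4] at h1

theorem hasSum_zpow_mul_inv_sub_inv_add {ε : ℂ} (hε : ε = 1 ∨ ε = -1) (n : ℕ) :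
    HasSum (fun m : ℤ ↦ ε ^ m * ((m : ℂ)⁻¹ - ((m : ℂ) + n)⁻¹)) 0 := by
  have hε0 : ε ≠ 0 := by rcases hε with rfl | rfl <;> norm_num
  induction n with
  | zero => simp
  | succ n ih =>
    have h := ((Equiv.addRight (n : ℤ)).hasSum_iff).2 (hasSum_zpow_mul_inv_sub_inv_succ hε)
    refine hasSum_of_eq (ih.add (h.mul_left (ε ^ (-n : ℤ)))) (fun m ↦ ?_) ?_
    · simp only [Function.comp, Equiv.coe_addRight]
      rw [← mul_assoc, ← zpow_add₀ hε0]
      push_cast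
      rw [show (-n + (m + n) : ℤ) = m by ring, add_assoc]
      ring
    · simp

/-- The general term of `∑ₘ ε ^ m / (m ^ p * (m + n) ^ r)`, omitting the poles `m = 0, -n`. -/
noncomputable def shiftTerm (ε : ℂ) (n p r : ℕ) (m : ℤ) : ℂ :=
  if m = 0 ∨ m + n = 0 then 0 else ε ^ m * ((m : ℂ)⁻¹) ^ p * (((m : ℂ) + n)⁻¹) ^ r

theorem shiftTerm_succ_succ (ε : ℂ) {n : ℕ} (hn : n ≠ 0) (p r : ℕ) (m : ℤ) :
    shiftTerm ε n (p + 1) (r + 1) m =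
      (n : ℂ)⁻¹ * (shiftTerm ε n (p + 1) r m - shiftTerm ε n p (r + 1) m) := by
  unfold shiftTerm
  split_ifs with h
  · simp
  · push Not at h
    have h1 : (m : ℂ) ≠ 0 := by exact_mod_cast h.1
    have h2 : (m : ℂ) + n ≠ 0 := by exact_mod_cast h.2
    have h3 : (n : ℂ) ≠ 0 := by exact_mod_cast hn
    have h4 : (m : ℂ)⁻¹ * ((m : ℂ) + n)⁻¹ = (n : ℂ)⁻¹ * ((m : ℂ)⁻¹ - ((m : ℂ) + n)⁻¹) := by
      field_simp
      ring
    linear_combination (ε ^ m * ((m : ℂ)⁻¹) ^ p * (((m : ℂ) + n)⁻¹) ^ r) * h4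

theorem hasSum_shiftTerm_one_one {ε : ℂ} (hε : ε = 1 ∨ ε = -1) {n : ℕ} (hn : n ≠ 0) :
    HasSum (shiftTerm ε n 1 1) ((1 + ε ^ n) * ((n : ℂ)⁻¹) ^ 2) := by
  have h := hasSum_zpow_mul_inv_sub_inv_add hε n
  have h0 := hasSum_ite_eq (0 : ℤ) ((n : ℂ)⁻¹)
  have h1 := hasSum_ite_eq (-n : ℤ) (ε ^ (-n : ℤ) * (n : ℂ)⁻¹)
  have h3 : (n : ℂ) ≠ 0 := by exact_mod_cast hn
  refine hasSum_of_eq (((h.add h0).add h1).mul_left ((n : ℂ)⁻¹)) (fun m ↦ ?_) ?_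
  · rw [shiftTerm_succ_succ ε hn 0 0]
    unfold shiftTerm
    by_cases hm0 : m = 0
    · subst hm0
      simp [hn]
    · by_cases hmn : m = -n
      · subst hmn
        simp [hn]
      · have : m + n ≠ 0 := by omega
        simp only [hm0, hmn, this, or_self, if_false, zero_add, pow_one, pow_zero, mul_one, add_zero]
        ring
  · rw [zpow_neg_eq_of_sign hε, zpow_natCast]
    ring

/-- Up to the factor `2 * (-1) ^ p / n ^ (p + r)`, the value of `∑ₘ ε ^ m / (m ^ p * (m + n) ^ r)`.
The truncation parameter `M` is irrelevant once it is large. -/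
noncomputable def shiftValue (ε : ℂ) (L : ℕ → ℂ) (M n p r : ℕ) : ℂ :=
  ∑ j ∈ range M, (ε ^ n * pascalCoeff j r p + pascalCoeff j p r) * L (2 * j) * (n : ℂ) ^ (2 * j)

theorem shiftValue_succ_succ (ε : ℂ) (L : ℕ → ℂ) (M n p r : ℕ) :
    shiftValue ε L M n (p + 1) (r + 1) =
      shiftValue ε L M n p (r + 1) + shiftValue ε L M n (p + 1) r := by
  simp only [shiftValue, ← sum_add_distrib, pascalCoeff_succ_succ]
  refine sum_congr rfl fun j _ ↦ ?_
  push_cast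
  ring

theorem sum_pascalCoeff_zero_left (f : ℕ → ℂ) {M b : ℕ} (hM : M ≠ 0) (hb : b ≠ 0) :
    ∑ j ∈ range M, (pascalCoeff j 0 b : ℂ) * f (2 * j) = f 0 := by
  rw [sum_eq_single 0]
  · simp [pascalCoeff_zero_left, hb]
  · intro j _ hj
    simp [pascalCoeff_zero_left, hb, hj]
  · simp [hM]

theorem sum_pascalCoeff_zero_right (f : ℕ → ℂ) {M a : ℕ} (hM : a ≤ M) (ha : a ≠ 0) :
    2 * ∑ j ∈ range M, (pascalCoeff j a 0 : ℂ) * f (2 * j) = (1 + (-1) ^ a) * f a := by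
  rcases Nat.even_or_odd' a with ⟨k, rfl | rfl⟩
  · rw [sum_eq_single k]
    · simp [pascalCoeff]
      norm_num
    · intro j _ hj
      simp [pascalCoeff, Ne.symm hj]
    · intro h
      simp only [mem_range] at h
      omega
  · rw [sum_eq_zero]
    · simp [pow_succ]
    · intro j _
      simp [pascalCoeff, show 2 * k + 1 ≠ 2 * j by omega]

theorem shiftValue_zero_right (ε : ℂ) {L : ℕ → ℂ} (hL : L 0 = -1 / 2) {M p : ℕ} (n : ℕ)
    (hM : p ≤ M) (hp : p ≠ 0) :
    2 * shiftValue ε L M n p 0 = (1 + (-1) ^ p) * L p * (n : ℂ) ^ p - ε ^ n := by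
  have h1 := sum_pascalCoeff_zero_left (fun j ↦ L j * (n : ℂ) ^ j) (show M ≠ 0 by omega) hp
  have h2 := sum_pascalCoeff_zero_right (fun j ↦ L j * (n : ℂ) ^ j) hM hp
  have h3 : shiftValue ε L M n p 0 =
      ε ^ n * ∑ j ∈ range M, (pascalCoeff j 0 p : ℂ) * (L (2 * j) * (n : ℂ) ^ (2 * j)) +
        ∑ j ∈ range M, (pascalCoeff j p 0 : ℂ) * (L (2 * j) * (n : ℂ) ^ (2 * j)) := by
    rw [mul_sum, ← sum_add_distrib]
    exact sum_congr rfl fun j _ ↦ by ring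
  rw [h3, mul_add, h2, h1, hL]
  ring

theorem shiftValue_comm {ε : ℂ} (hε : ε = 1 ∨ ε = -1) (L : ℕ → ℂ) (M n p r : ℕ) :
    shiftValue ε L M n p r = ε ^ n * shiftValue ε L M n r p := by
  have h : ε ^ n * ε ^ n = 1 := by
    rw [← mul_pow]
    rcases hε with rfl | rfl <;> simp
  rw [shiftValue, shiftValue, mul_sum]
  refine sum_congr rfl fun j _ ↦ ?_
  linear_combination (-(pascalCoeff j p r : ℂ) * L (2 * j) * (n : ℂ) ^ (2 * j)) * h

theorem hasSum_shiftTerm_zero_right {ε : ℂ} (hε : ε = 1 ∨ ε = -1) {L : ℕ → ℂ}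
    (hL : IsTwistedZeta ε L) {M n p : ℕ} (hn : n ≠ 0) (hM : p ≤ M) (hp : 2 ≤ p) :
    HasSum (shiftTerm ε n p 0)
      (2 * (-1) ^ p * shiftValue ε L M n p 0 * ((n : ℂ)⁻¹) ^ p) := by
  have h := hL.hasSum_int hε hp
  have h1 := hasSum_ite_eq (-n : ℤ) (ε ^ (-n : ℤ) * ((-n : ℂ)⁻¹) ^ p)
  have hp0 : p ≠ 0 := by omega
  refine hasSum_of_eq (h.sub h1) (fun m ↦ ?_) ?_
  · unfold shiftTerm
    by_cases hm0 : m = 0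
    · subst hm0
      simp [hn, hp0]
    · by_cases hmn : m = -n
      · subst hmn
        simp
      · have : m + n ≠ 0 := by omega
        simp [hm0, hmn, this]
  · have hn' : (n : ℂ) ^ p ≠ 0 := pow_ne_zero _ (by exact_mod_cast hn)
    have hsq : ((-1 : ℂ)) ^ p * (-1) ^ p = 1 := by rw [← mul_pow]; simp
    rw [zpow_neg_eq_of_sign hε, zpow_natCast, inv_neg, neg_pow (n : ℂ)⁻¹, inv_pow,
      show 2 * (-1) ^ p * shiftValue ε L M n p 0 = (-1) ^ p * (2 * shiftValue ε L M n p 0) by ring,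
      shiftValue_zero_right ε hL.1 n hM hp0]
    field_simp
    linear_combination (L p * (n : ℂ) ^ p) * hsq

theorem shiftTerm_sub_comm {ε : ℂ} (hε : ε = 1 ∨ ε = -1) (n p r : ℕ) (m : ℤ) :
    shiftTerm ε n p r (-n - m) = ε ^ n * (-1) ^ (p + r) * shiftTerm ε n r p m := by
  have hε0 : ε ≠ 0 := by rcases hε with rfl | rfl <;> norm_num
  unfold shiftTerm
  by_cases h : m = 0 ∨ m + n = 0
  · rw [if_pos h, if_pos (by omega), mul_zero]
  · rw [if_neg h, if_neg (by omega), show (-n - m : ℤ) = -n + -m by ring, zpow_add₀ hε0,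
      zpow_neg_eq_of_sign hε, zpow_neg_eq_of_sign hε, zpow_natCast]
    push_cast
    rw [show (-n + -m : ℂ) = -(m + n) by ring, show (-(m + n) + n : ℂ) = -m by ring, inv_neg,
      inv_neg, neg_pow, neg_pow (m : ℂ)⁻¹]
    ring

theorem hasSum_shiftTerm_zero_left {ε : ℂ} (hε : ε = 1 ∨ ε = -1) {L : ℕ → ℂ}
    (hL : IsTwistedZeta ε L) {M n r : ℕ} (hn : n ≠ 0) (hM : r ≤ M) (hr : 2 ≤ r) :
    HasSum (shiftTerm ε n 0 r) (2 * shiftValue ε L M n 0 r * ((n : ℂ)⁻¹) ^ r) := by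
  have h := ((Equiv.subLeft (-n : ℤ)).hasSum_iff).2 (hasSum_shiftTerm_zero_right hε hL hn hM hr)
  have h1 : ε ^ n * ε ^ n = 1 := by
    rw [← mul_pow]
    rcases hε with rfl | rfl <;> simp
  have hsq : ((-1 : ℂ)) ^ r * (-1) ^ r = 1 := by rw [← mul_pow]; simp
  refine hasSum_of_eq (h.mul_left (ε ^ n * (-1) ^ r)) (fun m ↦ ?_) ?_
  · simp only [Function.comp, Equiv.subLeft_apply]
    rw [shiftTerm_sub_comm hε, add_zero]
    linear_combination (-shiftTerm ε n 0 r m * ((-1) ^ r * (-1) ^ r)) * h1 -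
      shiftTerm ε n 0 r m * hsq
  · rw [shiftValue_comm hε]
    linear_combination (-2 * ε ^ n * shiftValue ε L M n r 0 * ((n : ℂ)⁻¹) ^ r) * hsq

theorem hasSum_shiftTerm {ε : ℂ} (hε : ε = 1 ∨ ε = -1) {L : ℕ → ℂ}
    (hL : IsTwistedZeta ε L) {M n : ℕ} (hn : n ≠ 0) (p r : ℕ) (hM : p + r ≤ M) (h2 : 2 ≤ p + r) :
    HasSum (shiftTerm ε n p r)
      (2 * (-1) ^ p * shiftValue ε L M n p r * ((n : ℂ)⁻¹) ^ (p + r)) := by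
  induction h : p + r generalizing p r with
  | zero => omega
  | succ w ih =>
    rcases p with _ | p
    · obtain rfl : r = w + 1 := by omega
      simpa using hasSum_shiftTerm_zero_left hε hL hn (show w + 1 ≤ M by omega) (by omega)
    rcases r with _ | r
    · rw [← h]
      exact hasSum_shiftTerm_zero_right hε hL hn (show p + 1 ≤ M by omega) (by omega)
    by_cases hpr : p + r = 0
    · obtain ⟨rfl, rfl⟩ : p = 0 ∧ r = 0 := by omega
      have hv := shiftValue_zero_right ε hL.1 n (show 1 ≤ M by omega) one_ne_zero
      have hε2 : ε ^ n * ε ^ n = 1 := by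
        rw [← mul_pow]
        rcases hε with rfl | rfl <;> simp
      refine hasSum_of_eq (hasSum_shiftTerm_one_one hε hn) (fun _ ↦ rfl) ?_
      rw [shiftValue_succ_succ, shiftValue_comm hε, ← h]
      simp only [pow_one, zero_add] at hv ⊢
      linear_combination ((n : ℂ)⁻¹ ^ 2) * (hε2 - (ε ^ n + 1) * hv)
    · have h1 := ih (p + 1) r (by omega) (by omega) (by omega)
      have h3 := ih p (r + 1) (by omega) (by omega) (by omega)
      refine hasSum_of_eq ((h1.sub h3).mul_left ((n : ℂ)⁻¹)) (shiftTerm_succ_succ ε hn p r) ?_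
      rw [shiftValue_succ_succ]
      ring

/-- The common shape of `N₁`, `N₂` and `N₃`. -/
noncomputable def twistedN (Z L : ℕ → ℂ) (a b s : ℕ) : ℂ :=
  ∑ j ∈ range (a / 2 + 1),
    ((a + b - 2 * j - 1).choose (b - 1) : ℂ) * Z (2 * j) * L (a + b + s - 2 * j)

theorem hasSum_twistedN {δ : ℂ} {L : ℕ → ℂ} (hL : IsTwistedZeta δ L) (Z : ℕ → ℂ) {a b s M : ℕ}
    (hb : b ≠ 0) (hs : s ≠ 0) (hM : a < M) :
    HasSum (fun k : ℕ ↦ δ ^ (k + 1) * (((k + 1 : ℕ) : ℂ)⁻¹) ^ s *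
      (∑ j ∈ range M, (pascalCoeff j a b : ℂ) * Z (2 * j) * ((k + 1 : ℕ) : ℂ) ^ (2 * j)) *
      (((k + 1 : ℕ) : ℂ)⁻¹) ^ (a + b)) (twistedN Z L a b s) := by
  have hsum := hasSum_sum (s := range (a / 2 + 1))
    (f := fun j (k : ℕ) ↦ ((a + b - 2 * j - 1).choose (b - 1) : ℂ) * Z (2 * j) *
      (δ ^ (k + 1) * ((k + 1 : ℂ)⁻¹) ^ (a + b + s - 2 * j))) fun j hj ↦
    (hL.2 (a + b + s - 2 * j) (by simp only [mem_range] at hj; omega)).mul_left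
      (((a + b - 2 * j - 1).choose (b - 1) : ℂ) * Z (2 * j))
  refine hasSum_of_eq hsum (fun k ↦ ?_) rfl
  rw [← sum_subset (range_subset_range.2 (show a / 2 + 1 ≤ M by omega)), mul_sum, sum_mul]
  · refine sum_congr rfl fun j hj ↦ ?_
    have hj' : 2 * j ≤ a := by
      simp only [mem_range] at hj
      omega
    have hk : ((k + 1 : ℕ) : ℂ) ≠ 0 := by exact_mod_cast k.succ_ne_zero
    have hpow : (((k + 1 : ℕ) : ℂ)⁻¹) ^ s * ((k + 1 : ℕ) : ℂ) ^ (2 * j) *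
        (((k + 1 : ℕ) : ℂ)⁻¹) ^ (a + b) = (((k + 1 : ℕ) : ℂ)⁻¹) ^ (a + b + s - 2 * j) := by
      have he : a + b + s = (a + b + s - 2 * j) + 2 * j := by omega
      have h1 : (((k + 1 : ℕ) : ℂ)⁻¹) ^ (2 * j) * ((k + 1 : ℕ) : ℂ) ^ (2 * j) = 1 := by
        rw [← mul_pow, inv_mul_cancel₀ hk, one_pow]
      calc _ = (((k + 1 : ℕ) : ℂ)⁻¹) ^ (a + b + s) * ((k + 1 : ℕ) : ℂ) ^ (2 * j) := by
            rw [pow_add _ (a + b) s]; ring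
        _ = _ := by rw [he, pow_add, mul_assoc, h1, ← he, mul_one]
    rw [← Nat.cast_add_one, ← hpow]
    simp only [pascalCoeff, hb, if_false, hj', if_true]
    ring
  · intro j _ hj
    have hj' : ¬ 2 * j ≤ a := by
      simp only [mem_range] at hj
      omega
    simp [pascalCoeff, hb, hj']

theorem hasSum_shiftValue {ε δ : ℂ} (Z : ℕ → ℂ) {L L' : ℕ → ℂ} (hL : IsTwistedZeta (δ * ε) L)
    (hL' : IsTwistedZeta δ L') {p r s M : ℕ} (hp : p ≠ 0) (hr : r ≠ 0) (hs : s ≠ 0)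
    (hpM : p < M) (hrM : r < M) :
    HasSum (fun k : ℕ ↦ δ ^ (k + 1) * (((k + 1 : ℕ) : ℂ)⁻¹) ^ s *
      (2 * (-1) ^ p * shiftValue ε Z M (k + 1) p r * (((k + 1 : ℕ) : ℂ)⁻¹) ^ (p + r)))
      (2 * (-1) ^ p * (twistedN Z L r p s + twistedN Z L' p r s)) := by
  refine hasSum_of_eq (((hasSum_twistedN hL Z hp hs hrM).add
    (hasSum_twistedN hL' Z hr hs hpM)).mul_left (2 * (-1) ^ p)) (fun k ↦ ?_) rfl
  have h : shiftValue ε Z M (k + 1) p r =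
      ε ^ (k + 1) * ∑ j ∈ range M, (pascalCoeff j r p : ℂ) * Z (2 * j) *
        ((k + 1 : ℕ) : ℂ) ^ (2 * j) +
      ∑ j ∈ range M, (pascalCoeff j p r : ℂ) * Z (2 * j) * ((k + 1 : ℕ) : ℂ) ^ (2 * j) := by
    rw [shiftValue, mul_sum, ← sum_add_distrib]
    exact sum_congr rfl fun j _ ↦ by ring
  rw [h, mul_pow, add_comm r p]
  ring

theorem N₁_eq_twistedN (a b s : ℕ) :
    N₁ a b s = twistedN (fun k ↦ riemannZeta k)
      (fun k ↦ ((2 : ℂ) ^ (1 - k : ℤ) - 1) * riemannZeta k) a b s := by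
  refine sum_congr rfl fun j hj ↦ ?_
  have hj' : 2 * j ≤ a + b + s := by
    simp only [mem_range] at hj
    omega
  rw [show (2 * j + 1 : ℤ) - a - b - s = 1 - ((a + b + s - 2 * j : ℕ) : ℤ) by omega]
  push_cast
  ring

theorem N₂_eq_twistedN (a b s : ℕ) :
    N₂ a b s = twistedN (fun k ↦ ((2 : ℂ) ^ (1 - k : ℤ) - 1) * riemannZeta k)
      (fun k ↦ ((2 : ℂ) ^ (1 - k : ℤ) - 1) * riemannZeta k) a b s := by
  refine sum_congr rfl fun j hj ↦ ?_
  have hj' : 2 * j ≤ a + b + s := by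
    simp only [mem_range] at hj
    omega
  rw [show (2 * j + 1 : ℤ) - a - b - s = 1 - ((a + b + s - 2 * j : ℕ) : ℤ) by omega]
  push_cast
  ring

theorem N₃_eq_twistedN (a b s : ℕ) :
    N₃ a b s = twistedN (fun k ↦ ((2 : ℂ) ^ (1 - k : ℤ) - 1) * riemannZeta k)
      (fun k ↦ riemannZeta k) a b s := by
  refine sum_congr rfl fun j _ ↦ ?_
  push_cast
  ring

/-- An odd function on `ℤ × ℤ` vanishing on the axes: the contributions of the second and fourth
quadrants to two adjacent half planes cancel. -/
theorem tsum_halfPlane_add_tsum_halfPlane {f : ℤ × ℤ → ℂ} (hf : Summable f)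
    (hodd : ∀ m n, f (-m, -n) = -f (m, n)) (hl : ∀ n, f (0, n) = 0) (hr : ∀ m, f (m, 0) = 0) :
    (∑' (k : ℕ) (m : ℤ), f (m, (k + 1 : ℕ))) + ∑' (k : ℕ) (n : ℤ), f ((k + 1 : ℕ), n) =
      2 * ∑' (m : ℕ) (n : ℕ), f ((m : ℤ) + 1, (n : ℤ) + 1) := by
  have hpp : Summable fun x : ℕ × ℕ ↦ f ((x.1 : ℤ) + 1, (x.2 : ℤ) + 1) :=
    hf.comp_injective (i := fun x : ℕ × ℕ ↦ ((x.1 : ℤ) + 1, (x.2 : ℤ) + 1)) fun x y h ↦ by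
      simpa [Prod.ext_iff] using h
  have hnp : Summable fun x : ℕ × ℕ ↦ f (-((x.1 : ℤ) + 1), (x.2 : ℤ) + 1) :=
    hf.comp_injective (i := fun x : ℕ × ℕ ↦ (-((x.1 : ℤ) + 1), (x.2 : ℤ) + 1)) fun x y h ↦ by
      simpa [Prod.ext_iff] using h
  have hpp' : Summable fun x : ℕ × ℕ ↦ f ((x.2 : ℤ) + 1, (x.1 : ℤ) + 1) := hpp.prod_symm
  have hnp' : Summable fun x : ℕ × ℕ ↦ f (-((x.2 : ℤ) + 1), (x.1 : ℤ) + 1) := hnp.prod_symm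
  have hinner (k : ℕ) : ∑' m : ℤ, f (m, (k + 1 : ℕ)) =
      ∑' m : ℕ, f ((m : ℤ) + 1, (k : ℤ) + 1) + ∑' m : ℕ, f (-((m : ℤ) + 1), (k : ℤ) + 1) := by
    rw [tsum_of_add_one_of_neg_add_one (f := fun m : ℤ ↦ f (m, (k + 1 : ℕ)))
      (hpp'.prod_factor k) (hnp'.prod_factor k), hl]
    simp
  have hinner' (k : ℕ) : ∑' n : ℤ, f ((k + 1 : ℕ), n) =
      ∑' n : ℕ, f ((k : ℤ) + 1, (n : ℤ) + 1) - ∑' n : ℕ, f (-((k : ℤ) + 1), (n : ℤ) + 1) := by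
    have h (n : ℕ) : f ((k : ℤ) + 1, -((n : ℤ) + 1)) = -f (-((k : ℤ) + 1), (n : ℤ) + 1) := by
      rw [← hodd, neg_neg]
    rw [tsum_of_add_one_of_neg_add_one (f := fun n : ℤ ↦ f ((k + 1 : ℕ), n))
      (hpp.prod_factor k) ((hnp.prod_factor k).neg.congr fun n ↦ (h n).symm), hr]
    push_cast
    simp only [h, tsum_neg]
    ring
  simp only [hinner, hinner']
  rw [hpp'.prod.tsum_add hnp'.prod, hpp.prod.tsum_sub hnp.prod,
    Summable.tsum_comm (f := fun m k : ℕ ↦ f ((m : ℤ) + 1, (k : ℤ) + 1)) hpp,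
    Summable.tsum_comm (f := fun m k : ℕ ↦ f (-((m : ℤ) + 1), (k : ℤ) + 1)) hnp]
  ring

/-- The general term of the double series, on all of `ℤ × ℤ`; it vanishes at the poles. -/
noncomputable def tornheimTerm (p q r : ℕ) (x : ℤ × ℤ) : ℂ :=
  (-1) ^ x.2 * ((x.1 : ℂ)⁻¹) ^ p * ((x.2 : ℂ)⁻¹) ^ q * (((x.1 : ℂ) + x.2)⁻¹) ^ r

theorem summable_tornheimTerm {p q r : ℕ} (hp : 1 ≤ p) (hq : 1 ≤ q) (hr : 2 ≤ r) :
    Summable (tornheimTerm p q r) := by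
  set u : ℤ → ℝ := fun m ↦ ‖(m : ℂ)⁻¹‖ with hu
  have hu0 (m : ℤ) : 0 ≤ u m := norm_nonneg _
  have hu1 (m : ℤ) : u m ≤ 1 := by
    rcases eq_or_ne m 0 with rfl | hm
    · simp [hu]
    · rw [hu]
      simp only [norm_inv, Complex.norm_intCast]
      exact inv_le_one_of_one_le₀ (by exact_mod_cast Int.one_le_abs hm)
  have hsq : Summable fun m ↦ u m ^ 2 := by
    refine (Real.summable_one_div_int_pow (p := 2)).2 one_lt_two |>.congr fun m ↦ ?_
    simp [hu]
  have hprod : Summable fun x : ℤ × ℤ ↦ u x.1 ^ 2 * u x.2 ^ 2 :=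
    hsq.mul_of_nonneg hsq (fun _ ↦ by positivity) fun _ ↦ by positivity
  have h1 : Summable fun x : ℤ × ℤ ↦ u x.1 ^ 2 * u (x.1 + x.2) ^ 2 :=
    hprod.comp_injective (i := fun x : ℤ × ℤ ↦ (x.1, x.1 + x.2)) fun x y h ↦ by
      simp only [Prod.ext_iff] at h ⊢
      omega
  have h2 : Summable fun x : ℤ × ℤ ↦ u x.2 ^ 2 * u (x.1 + x.2) ^ 2 :=
    hprod.comp_injective (i := fun x : ℤ × ℤ ↦ (x.2, x.1 + x.2)) fun x y h ↦ by
      simp only [Prod.ext_iff] at h ⊢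
      omega
  refine Summable.of_norm_bounded (h1.add h2) fun x ↦ ?_
  have hnorm : ‖tornheimTerm p q r x‖ = u x.1 ^ p * u x.2 ^ q * u (x.1 + x.2) ^ r := by
    simp only [tornheimTerm, ← Int.cast_add, norm_mul, norm_pow, norm_zpow, norm_neg, norm_one,
      one_zpow, one_mul, hu]
  have hp' : u x.1 ^ p ≤ u x.1 := pow_le_of_le_one (hu0 _) (hu1 _) (by omega)
  have hq' : u x.2 ^ q ≤ u x.2 := pow_le_of_le_one (hu0 _) (hu1 _) (by omega)
  have hr' : u (x.1 + x.2) ^ r ≤ u (x.1 + x.2) ^ 2 := pow_le_pow_of_le_one (hu0 _) (hu1 _) hr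
  calc ‖tornheimTerm p q r x‖ ≤ u x.1 * u x.2 * u (x.1 + x.2) ^ 2 := by
        rw [hnorm]
        gcongr
    _ ≤ (u x.1 ^ 2 + u x.2 ^ 2) * u (x.1 + x.2) ^ 2 := by
        gcongr
        nlinarith [sq_nonneg (u x.1 - u x.2), sq_nonneg (u x.1), sq_nonneg (u x.2)]
    _ = _ := by ring

theorem ofReal_tornheimR (p q r : ℕ) :
    (tornheimR p q r : ℂ) =
      ∑' (m : ℕ) (n : ℕ), tornheimTerm p q r ((m : ℤ) + 1, (n : ℤ) + 1) := by
  simp only [tornheimR, Complex.ofReal_tsum]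
  refine tsum_congr fun m ↦ tsum_congr fun n ↦ ?_
  simp only [tornheimTerm, Real.rpow_natCast]
  rw [show ((n : ℤ) + 1) = ((n + 1 : ℕ) : ℤ) by push_cast; rfl, zpow_natCast]
  push_cast
  rw [show (m + 1 + (n + 1) : ℂ) = m + n + 2 by ring]
  simp only [div_eq_mul_inv, mul_inv, inv_pow]
  ring

theorem tornheimTerm_neg {p q r : ℕ} (hodd : Odd (p + q + r)) (m n : ℤ) :
    tornheimTerm p q r (-m, -n) = -tornheimTerm p q r (m, n) := by
  have h : ((-1 : ℂ)) ^ p * (-1) ^ q * (-1) ^ r = -1 := by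
    rw [← pow_add, ← pow_add, hodd.neg_one_pow]
  simp only [tornheimTerm]
  rw [zpow_neg_eq_of_sign (.inr rfl)]
  push_cast
  rw [← neg_add, inv_neg, inv_neg, inv_neg, neg_pow (m : ℂ)⁻¹, neg_pow (n : ℂ)⁻¹,
    neg_pow ((m : ℂ) + n)⁻¹]
  linear_combination
    ((-1) ^ n * ((m : ℂ)⁻¹) ^ p * ((n : ℂ)⁻¹) ^ q * (((m : ℂ) + n)⁻¹) ^ r) * h

theorem tornheimTerm_eq_shiftTerm_left {p r : ℕ} (hp : p ≠ 0) (hr : r ≠ 0) (q n : ℕ) (m : ℤ) :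
    tornheimTerm p q r (m, n) = (-1) ^ n * ((n : ℂ)⁻¹) ^ q * shiftTerm 1 n p r m := by
  unfold tornheimTerm shiftTerm
  split_ifs with h
  · rcases h with rfl | h
    · simp [hp]
    · have : (m : ℂ) + n = 0 := by exact_mod_cast h
      simp [this, hr]
  · simp
    ring

theorem tornheimTerm_eq_shiftTerm_right {q r : ℕ} (hq : q ≠ 0) (hr : r ≠ 0) (p m : ℕ) (n : ℤ) :
    tornheimTerm p q r (m, n) = 1 ^ m * ((m : ℂ)⁻¹) ^ p * shiftTerm (-1) m q r n := by
  unfold tornheimTerm shiftTerm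
  split_ifs with h
  · rcases h with rfl | h
    · simp [hq]
    · have : (m : ℂ) + n = 0 := by rw [add_comm]; exact_mod_cast h
      simp [this, hr]
  · simp [add_comm (m : ℂ)]
    ring

theorem eval_R_odd_weight (p q r : ℕ) (hp : 1 ≤ p) (hq : 1 ≤ q) (hr : 2 ≤ r)
    (hodd : Odd (p + q + r)) :
    (tornheimR p q r : ℂ) =
      (-1) ^ p * N₁ r p q + (-1) ^ p * N₁ p r q +
        (-1) ^ q * N₂ r q p + (-1) ^ q * N₃ q r p := by
  have h1 (k : ℕ) := ((hasSum_shiftTerm (.inl rfl) isTwistedZeta_one (M := p + q + r)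
    k.succ_ne_zero p r (by omega) (by omega)).mul_left
      ((-1) ^ (k + 1) * (((k + 1 : ℕ) : ℂ)⁻¹) ^ q)).tsum_eq
  have h2 (k : ℕ) := ((hasSum_shiftTerm (.inr rfl) isTwistedZeta_neg_one (M := p + q + r)
    k.succ_ne_zero q r (by omega) (by omega)).mul_left
      (1 ^ (k + 1) * (((k + 1 : ℕ) : ℂ)⁻¹) ^ p)).tsum_eq
  have h := tsum_halfPlane_add_tsum_halfPlane (summable_tornheimTerm hp hq hr)
    (tornheimTerm_neg hodd) (fun n ↦ by simp [tornheimTerm, show p ≠ 0 by omega])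
    (fun m ↦ by simp [tornheimTerm, show q ≠ 0 by omega])
  simp only [tornheimTerm_eq_shiftTerm_left (show p ≠ 0 by omega) (show r ≠ 0 by omega),
    tornheimTerm_eq_shiftTerm_right (show q ≠ 0 by omega) (show r ≠ 0 by omega), h1, h2] at h
  rw [(hasSum_shiftValue _ (by simpa using isTwistedZeta_neg_one) isTwistedZeta_neg_one
      (by omega) (by omega) (by omega) (by omega) (by omega)).tsum_eq,
    (hasSum_shiftValue _ (by simpa using isTwistedZeta_neg_one) isTwistedZeta_one
      (by omega) (by omega) (by omega) (by omega) (by omega)).tsum_eq,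
    ← ofReal_tornheimR] at h
  rw [N₁_eq_twistedN, N₁_eq_twistedN, N₂_eq_twistedN, N₃_eq_twistedN]
  linear_combination (-1 / 2 : ℂ) * h
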